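/- arXiv:2302.04668 — 3 statements merged into one kernel-verified Lean document; each statement's English description precedes it below -/
import Mathlib

section
/- If f and g are regular time warps, then the composition f ∘ g, the pointwise infimum f ⊓ g, and the pointwise supremum f ⊔ g are regular time warps, and the identity map id : ℕ∞ → ℕ∞ is a regular time warp. -/
/-- A map `f : ℕ∞ → ℕ∞` preserves arbitrary suprema. -/
def PreservesSSup (f : ℕ∞ → ℕ∞) : Prop :=
  ∀ S : Set ℕ∞, f (sSup S) = sSup (f '' S)

/-- `f` is eventually constant: from some `m : ℕ` on, `f` takes the value `f m`. -/
def EventuallyConstant (f : ℕ∞ → ℕ∞) : Prop :=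
  ∃ m : ℕ, ∀ n : ℕ, m ≤ n → f n = f m

/-- `f` is eventually linear: there are `m : ℕ` and `k : ℤ` with `f n = n + k`
for all natural `n ≥ m`. -/
def EventuallyLinear (f : ℕ∞ → ℕ∞) : Prop :=
  ∃ (m : ℕ) (k : ℤ), ∀ n : ℕ, m ≤ n → ∃ j : ℕ, f n = (j : ℕ∞) ∧ (j : ℤ) = (n : ℤ) + k

/-- `f` is regular: eventually constant or eventually linear. -/
def RegularW (f : ℕ∞ → ℕ∞) : Prop := EventuallyConstant f ∨ EventuallyLinear f

theorem PreservesSSup.monotone {f : ℕ∞ → ℕ∞} (hf : PreservesSSup f) : Monotone f := by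
  intro a b hab
  have h := hf {a, b}
  rw [sSup_pair, sup_eq_right.2 hab, Set.image_pair, sSup_pair] at h
  exact h ▸ le_sup_left

theorem PreservesSSup.comp {f g : ℕ∞ → ℕ∞} (hf : PreservesSSup f) (hg : PreservesSSup g) :
    PreservesSSup (f ∘ g) := by
  intro S
  rw [Function.comp_apply, hg S, hf, Set.image_comp]

theorem PreservesSSup.sup {f g : ℕ∞ → ℕ∞} (hf : PreservesSSup f) (hg : PreservesSSup g) :
    PreservesSSup (fun x => f x ⊔ g x) := by
  intro S
  simp only [hf S, hg S, sSup_image, iSup_sup_eq]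

theorem PreservesSSup.inf {f g : ℕ∞ → ℕ∞} (hf : PreservesSSup f) (hg : PreservesSSup g) :
    PreservesSSup (fun x => f x ⊓ g x) := by
  intro S
  apply le_antisymm
  · simp only [hf S, hg S]
    rw [sSup_inf_sSup]
    refine iSup₂_le ?_
    rintro ⟨_, _⟩ ⟨⟨s, hs, rfl⟩, ⟨t, ht, rfl⟩⟩
    have hmem : s ⊔ t ∈ S := by
      rcases le_total s t with h | h <;> simpa [h]
    exact (inf_le_inf (hf.monotone le_sup_left) (hg.monotone le_sup_right)).trans
      (le_sSup (Set.mem_image_of_mem _ hmem))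
  · refine sSup_le ?_
    rintro _ ⟨s, hs, rfl⟩
    exact inf_le_inf (hf.monotone (le_sSup hs)) (hg.monotone (le_sSup hs))

theorem eventuallyConstant_of_eq {f : ℕ∞ → ℕ∞} {m : ℕ} {c : ℕ∞}
    (h : ∀ n : ℕ, m ≤ n → f n = c) : EventuallyConstant f :=
  ⟨m, fun n hn => (h n hn).trans (h m le_rfl).symm⟩

theorem RegularW.congr {f g : ℕ∞ → ℕ∞} (m : ℕ) (h : ∀ n : ℕ, m ≤ n → g n = f n)
    (hf : RegularW f) : RegularW g := by
  rcases hf with ⟨a, ha⟩ | ⟨a, k, ha⟩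
  · refine .inl (eventuallyConstant_of_eq (m := max a m) (c := f a) fun n hn => ?_)
    rw [h n (by omega), ha n (by omega)]
  · refine .inr ⟨max a m, k, fun n hn => ?_⟩
    rw [h n (by omega)]
    exact ha n (by omega)

theorem RegularW.comp {f g : ℕ∞ → ℕ∞} (hf : RegularW f) (hg : RegularW g) :
    RegularW (f ∘ g) := by
  rcases hg with ⟨b, hb⟩ | ⟨b, l, hb⟩
  · refine .inl ⟨b, fun n hn => ?_⟩
    simp only [Function.comp_apply, hb n hn]
  rcases hf with ⟨a, ha⟩ | ⟨a, k, ha⟩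
  · refine .inl (eventuallyConstant_of_eq (m := b + a + l.natAbs) (c := f a) fun n hn => ?_)
    obtain ⟨j, hj, hjl⟩ := hb n (by omega)
    rw [Function.comp_apply, hj, ha j (by omega)]
  · refine .inr ⟨b + a + l.natAbs, l + k, fun n hn => ?_⟩
    obtain ⟨j, hj, hjl⟩ := hb n (by omega)
    obtain ⟨i, hi, hik⟩ := ha j (by omega)
    exact ⟨i, by rw [Function.comp_apply, hj, hi], by omega⟩

/-- Eventually, one of two regular maps stays below the other. -/
theorem RegularW.eventually_le_or_le {f g : ℕ∞ → ℕ∞} (hf : RegularW f) (hg : RegularW g) :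
    ∃ m : ℕ, (∀ n : ℕ, m ≤ n → f n ≤ g n) ∨ (∀ n : ℕ, m ≤ n → g n ≤ f n) := by
  have mixed : ∀ {f g : ℕ∞ → ℕ∞}, EventuallyConstant f → EventuallyLinear g →
      ∃ m : ℕ, (∀ n : ℕ, m ≤ n → f n ≤ g n) ∨ (∀ n : ℕ, m ≤ n → g n ≤ f n) := by
    rintro f g ⟨a, ha⟩ ⟨b, l, hb⟩
    rcases eq_or_ne (f a) ⊤ with hc | hc
    · exact ⟨a, .inr fun n hn => by simp [ha n hn, hc]⟩
    · obtain ⟨c, hc⟩ := ENat.ne_top_iff_exists.1 hc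
      refine ⟨a + b + c + l.natAbs, .inl fun n hn => ?_⟩
      obtain ⟨j, hj, hjl⟩ := hb n (by omega)
      rw [ha n (by omega), ← hc, hj, Nat.cast_le]
      omega
  rcases hf with hf | hf <;> rcases hg with hg | hg
  · obtain ⟨a, ha⟩ := hf
    obtain ⟨b, hb⟩ := hg
    refine ⟨max a b, (le_total (f a) (g b)).imp (fun h n hn => ?_) (fun h n hn => ?_)⟩ <;>
      rwa [ha n (by omega), hb n (by omega)]
  · exact mixed hf hg
  · obtain ⟨m, h⟩ := mixed hg hf
    exact ⟨m, h.symm⟩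
  · obtain ⟨a, k, ha⟩ := hf
    obtain ⟨b, l, hb⟩ := hg
    refine ⟨max a b, (le_total k l).imp (fun h n hn => ?_) (fun h n hn => ?_)⟩ <;>
    · obtain ⟨i, hi, hik⟩ := ha n (by omega)
      obtain ⟨j, hj, hjl⟩ := hb n (by omega)
      rw [hi, hj, Nat.cast_le]
      omega

theorem RegularW.inf {f g : ℕ∞ → ℕ∞} (hf : RegularW f) (hg : RegularW g) :
    RegularW (fun x => f x ⊓ g x) := by
  obtain ⟨m, h | h⟩ := hf.eventually_le_or_le hg
  · exact hf.congr m fun n hn => inf_eq_left.2 (h n hn)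
  · exact hg.congr m fun n hn => inf_eq_right.2 (h n hn)

theorem RegularW.sup {f g : ℕ∞ → ℕ∞} (hf : RegularW f) (hg : RegularW g) :
    RegularW (fun x => f x ⊔ g x) := by
  obtain ⟨m, h | h⟩ := hf.eventually_le_or_le hg
  · exact hg.congr m fun n hn => sup_eq_right.2 (h n hn)
  · exact hf.congr m fun n hn => sup_eq_left.2 (h n hn)

theorem preservesSSup_id : PreservesSSup (id : ℕ∞ → ℕ∞) := fun S => by simp

theorem regularW_id : RegularW (id : ℕ∞ → ℕ∞) :=
  .inr ⟨0, 0, fun n _ => ⟨n, rfl, by simp⟩⟩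

theorem stmt6 :
    (∀ f g : ℕ∞ → ℕ∞, PreservesSSup f → RegularW f → PreservesSSup g → RegularW g →
      (PreservesSSup (f ∘ g) ∧ RegularW (f ∘ g)) ∧
      (PreservesSSup (fun x => f x ⊓ g x) ∧ RegularW (fun x => f x ⊓ g x)) ∧
      (PreservesSSup (fun x => f x ⊔ g x) ∧ RegularW (fun x => f x ⊔ g x))) ∧
    (PreservesSSup (id : ℕ∞ → ℕ∞) ∧ RegularW (id : ℕ∞ → ℕ∞)) :=
  ⟨fun _ _ hf rf hg rg => ⟨⟨hf.comp hg, rf.comp rg⟩, ⟨hf.inf hg, rf.inf rg⟩,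
    ⟨hf.sup hg, rf.sup rg⟩⟩, preservesSSup_id, regularW_id⟩
end

section
/- Let X be a finite set of pairs in ℕ∞ × ℕ∞ which is a monotone partial function (if (i,j), (i',j') ∈ X then i ≤ i' implies j ≤ j', and i = i' implies j = j'), such that (0,0) ∈ X, (⊤, v) ∈ X for some v ∈ ℕ∞, and if v < ⊤ then there exists a natural number m with (m, v) ∈ X. Then there exists a regular time warp f with f i = j for every (i, j) ∈ X. -/
theorem preservesSSup_of_monotone {f : ℕ∞ → ℕ∞} (hf : Monotone f) (h0 : f 0 = 0)
    (htop : f ⊤ ≤ ⨆ n : ℕ, f n) : PreservesSSup f := by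
  intro S
  refine le_antisymm ?_ (sSup_le ?_)
  · rcases S.eq_empty_or_nonempty with rfl | hS
    · simp [h0]
    have := hS.to_subtype
    rcases lt_or_eq_of_le (le_top : sSup S ≤ ⊤) with h | h
    · exact le_sSup ⟨_, ENat.sSup_mem_of_nonempty_of_lt_top h, rfl⟩
    · rw [h]
      refine htop.trans (iSup_le fun n => ?_)
      obtain ⟨s, hs, hns⟩ := lt_sSup_iff.mp (h ▸ ENat.natCast_lt_top n : (n : ℕ∞) < sSup S)
      exact (hf hns.le).trans (le_sSup ⟨s, hs, rfl⟩)
  · rintro _ ⟨s, hs, rfl⟩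
    exact hf (le_sSup hs)

/-- The least monotone map lying above the partial function `Y`. -/
noncomputable def stepMap (Y : Set (ℕ∞ × ℕ∞)) (x : ℕ∞) : ℕ∞ :=
  ⨆ p ∈ Y, ⨆ _ : p.1 ≤ x, p.2

theorem le_stepMap {Y : Set (ℕ∞ × ℕ∞)} {p : ℕ∞ × ℕ∞} (hp : p ∈ Y) {x : ℕ∞} (h : p.1 ≤ x) :
    p.2 ≤ stepMap Y x :=
  le_iSup₂_of_le p hp (le_iSup_of_le h le_rfl)

theorem stepMap_le {Y : Set (ℕ∞ × ℕ∞)} {x b : ℕ∞} (h : ∀ p ∈ Y, p.1 ≤ x → p.2 ≤ b) :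
    stepMap Y x ≤ b :=
  iSup₂_le fun p hp => iSup_le fun hx => h p hp hx

theorem stepMap_monotone (Y : Set (ℕ∞ × ℕ∞)) : Monotone (stepMap Y) := fun _ _ hxy =>
  stepMap_le fun _ hp hx => le_stepMap hp (hx.trans hxy)

theorem stepMap_eq {Y : Set (ℕ∞ × ℕ∞)} (hmono : ∀ p ∈ Y, ∀ q ∈ Y, p.1 ≤ q.1 → p.2 ≤ q.2)
    {p : ℕ∞ × ℕ∞} (hp : p ∈ Y) : stepMap Y p.1 = p.2 :=
  le_antisymm (stepMap_le fun q hq h => hmono q hq p hp h) (le_stepMap hp le_rfl)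

/-- Any finite monotone partial function on `ℕ∞` containing `(0,0)`, defined at `⊤`,
and whose value at `⊤` is attained at a natural number whenever it is finite, extends
to a regular time warp. -/
theorem stmt13 (X : Set (ℕ∞ × ℕ∞)) (hfin : X.Finite)
    (hmono : ∀ p ∈ X, ∀ q ∈ X, p.1 ≤ q.1 → p.2 ≤ q.2)
    (hfun : ∀ p ∈ X, ∀ q ∈ X, p.1 = q.1 → p.2 = q.2)
    (h0 : ((0 : ℕ∞), (0 : ℕ∞)) ∈ X) (v : ℕ∞) (hv : ((⊤ : ℕ∞), v) ∈ X)
    (hvfin : v < ⊤ → ∃ m : ℕ, ((m : ℕ∞), v) ∈ X) :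
    ∃ f : ℕ∞ → ℕ∞, PreservesSSup f ∧ RegularW f ∧ ∀ p ∈ X, f p.1 = p.2 := by
  by_cases hm : ∃ m : ℕ, ((m : ℕ∞), v) ∈ X
  · obtain ⟨m, hm⟩ := hm
    have htop : stepMap X ⊤ = v := stepMap_eq hmono hv
    have hmv : stepMap X m = v := stepMap_eq hmono hm
    refine ⟨stepMap X, preservesSSup_of_monotone (stepMap_monotone X) (stepMap_eq hmono h0) ?_,
      Or.inl ⟨m, fun n hn => le_antisymm ?_ (stepMap_monotone X (by exact_mod_cast hn))⟩,
      fun p hp => stepMap_eq hmono hp⟩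
    · rw [htop, ← hmv]
      exact le_iSup (fun n : ℕ => stepMap X n) m
    · rw [hmv, ← htop]
      exact stepMap_monotone X le_top
  · obtain rfl : v = ⊤ := by
      by_contra h
      exact hm (hvfin (lt_top_iff_ne_top.mpr h))
    set Y : Set (ℕ∞ × ℕ∞) := {p ∈ X | p.1 ≠ ⊤}
    have hYX : ∀ p ∈ Y, p ∈ X := fun p hp => hp.1
    have hmonoY : ∀ p ∈ Y, ∀ q ∈ Y, p.1 ≤ q.1 → p.2 ≤ q.2 := fun p hp q hq =>
      hmono p hp.1 q hq.1
    have h0Y : ((0 : ℕ∞), (0 : ℕ∞)) ∈ Y := ⟨h0, by simp⟩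
    obtain ⟨⟨M, c⟩, hMc, hmax⟩ :=
      Set.exists_max_image Y Prod.fst (hfin.subset hYX) ⟨_, h0Y⟩
    obtain ⟨M, rfl⟩ := ENat.ne_top_iff_exists.mp hMc.2
    have hc : c ≠ ⊤ := by
      rintro rfl
      exact hm ⟨M, hMc.1⟩
    obtain ⟨c, rfl⟩ := ENat.ne_top_iff_exists.mp hc
    have hstep : ∀ n : ℕ, M ≤ n → stepMap Y n + ((n : ℕ∞) - M) = ((c + (n - M) : ℕ) : ℕ∞) := by
      intro n hn
      have : stepMap Y n = c := le_antisymm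
        (stepMap_le fun q hq _ => hmonoY q hq _ hMc (hmax q hq))
        (le_stepMap hMc (ENat.natCast_le_natCast.mpr hn))
      rw [this]
      push_cast
      rfl
    refine ⟨fun x => stepMap Y x + (x - M), preservesSSup_of_monotone ?_ ?_ ?_,
      Or.inr ⟨M, c - M, fun n hn => ⟨_, hstep n hn, by omega⟩⟩, fun p hp => ?_⟩
    · exact fun x y hxy => add_le_add (stepMap_monotone Y hxy) (tsub_le_tsub_right hxy _)
    · have : stepMap Y 0 = 0 := stepMap_eq (p := (0, 0)) hmonoY h0Y
      simp [this]
    · refine le_of_le_of_eq le_top (ENat.eq_top_iff_forall_ge.mpr fun b => ?_).symm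
      refine le_iSup_of_le (M + b) ?_
      rw [hstep _ (by omega)]
      exact_mod_cast (by omega : b ≤ c + (M + b - M))
    · by_cases hp1 : p.1 = ⊤
      · rw [hfun p hp _ hv hp1]
        simp [hp1]
      · have hpY : p ∈ Y := ⟨hp, hp1⟩
        simp only [stepMap_eq hmonoY hpY, tsub_eq_zero_of_le (hmax p hpY), add_zero]
end

section
/- Let T be a finite set of basic terms, κ₀ a time variable, and Δ the saturation of the sample set {t[κ₀] | t ∈ T}. Then for every assignment h : ℕ → W of time warps to variables and every n ∈ ℕ∞, there exists a Δ-diagram δ such that δ κ₀ = n and δ (t[κ₀]) = eval h t n for all t ∈ T. -/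
/-- The predecessor time warp: `pred 0 = 0`, `pred ⊤ = ⊤`, `pred (n+1) = n`. -/
def wpred (m : ℕ∞) : ℕ∞ := if m = ⊤ then ⊤ else ((m.toNat - 1 : ℕ) : ℕ∞)

/-- The involution `f⋆` of a time warp `f`: `f⋆ m = ⨅ {pred n | n ∈ ℕ∞, m ≤ f n}`. -/
noncomputable def winv (f : ℕ∞ → ℕ∞) : ℕ∞ → ℕ∞ :=
  fun m => sInf {y | ∃ n : ℕ∞, m ≤ f n ∧ y = wpred n}

/-- Terms in the language of the time warp algebra. -/
inductive Term : Type
  | var : ℕ → Term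
  | one : Term
  | mul : Term → Term → Term
  | star : Term → Term
  | meet : Term → Term → Term
  | join : Term → Term → Term

/-- Basic terms: built only from variables, `one`, `mul`, and `star`. -/
inductive IsBasic : Term → Prop
  | var (i : ℕ) : IsBasic (Term.var i)
  | one : IsBasic Term.one
  | mul {t u : Term} : IsBasic t → IsBasic u → IsBasic (Term.mul t u)
  | star {t : Term} : IsBasic t → IsBasic (Term.star t)

/-- The type of basic terms. -/
def BasicTerm : Type := {t : Term // IsBasic t}

/-- Product of basic terms. -/
def BasicTerm.mul (t u : BasicTerm) : BasicTerm := ⟨Term.mul t.1 u.1, IsBasic.mul t.2 u.2⟩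

/-- Star of a basic term. -/
def BasicTerm.star (t : BasicTerm) : BasicTerm := ⟨Term.star t.1, IsBasic.star t.2⟩

/-- The unit basic term. -/
def BasicTerm.one : BasicTerm := ⟨Term.one, IsBasic.one⟩

/-- Evaluation of a term under an assignment `h` of maps to variables. -/
noncomputable def eval (h : ℕ → ℕ∞ → ℕ∞) : Term → ℕ∞ → ℕ∞
  | Term.var i => h i
  | Term.one => id
  | Term.mul t u => eval h t ∘ eval h u
  | Term.star t => winv (eval h t)
  | Term.meet t u => fun x => eval h t x ⊓ eval h u x
  | Term.join t u => fun x => eval h t x ⊔ eval h u x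

/-- Samples: time variables `κ i`, applications `t[α]`, successors `suc α`,
and `last t` for basic terms `t`. -/
inductive Sample : Type
  | kappa : ℕ → Sample
  | app : BasicTerm → Sample → Sample
  | suc : Sample → Sample
  | lst : BasicTerm → Sample

/-- The one-step relation `⤳` on samples. -/
inductive Step : Sample → Sample → Prop
  | appDrop (t : BasicTerm) (α : Sample) : Step (Sample.app t α) α
  | sucDrop (α : Sample) : Step (Sample.suc α) α
  | toLast (t : BasicTerm) (α : Sample) : Step (Sample.app t α) (Sample.app t (Sample.lst t))
  | mulSplit (t u : BasicTerm) (α : Sample) :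
      Step (Sample.app (t.mul u) α) (Sample.app t (Sample.app u α))
  | starLow (t : BasicTerm) (α : Sample) :
      Step (Sample.app t.star α) (Sample.app t (Sample.app t.star α))
  | starHigh (t : BasicTerm) (α : Sample) :
      Step (Sample.app t.star α) (Sample.app t (Sample.suc (Sample.app t.star α)))

/-- The saturation of a sample set: its closure under `⤳*`. -/
def saturation (Δ : Set Sample) : Set Sample :=
  {β | ∃ α ∈ Δ, Relation.ReflTransGen Step α β}

/-- A sample set is saturated if it is closed under `⤳`. -/
def Saturated (Δ : Set Sample) : Prop :=
  ∀ α ∈ Δ, ∀ β : Sample, Step α β → β ∈ Δ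

/-- The successor map `S` on `ℕ∞`: `S n = n + 1` for `n : ℕ` and `S ⊤ = ⊤`. -/
def eS (m : ℕ∞) : ℕ∞ := m + 1

/-- A `Δ`-diagram: a valuation of samples in `ℕ∞` satisfying conditions (1)–(12). -/
structure IsDiagram (Δ : Set Sample) (δ : Sample → ℕ∞) : Prop where
  mon : ∀ (t : BasicTerm) (α β : Sample), Sample.app t α ∈ Δ → Sample.app t β ∈ Δ →
    δ α ≤ δ β → δ (Sample.app t α) ≤ δ (Sample.app t β)
  zero : ∀ (t : BasicTerm) (α : Sample), Sample.app t α ∈ Δ →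
    δ α = 0 → δ (Sample.app t α) = 0
  suc_eq : ∀ α : Sample, Sample.suc α ∈ Δ → δ (Sample.suc α) = eS (δ α)
  last_iff : ∀ (t : BasicTerm) (α : Sample), Sample.app t α ∈ Δ →
    (δ (Sample.lst t) ≤ δ α ↔ δ (Sample.app t (Sample.lst t)) = δ (Sample.app t α))
  last_top : ∀ t : BasicTerm, Sample.app t (Sample.lst t) ∈ Δ →
    δ (Sample.lst t) = ⊤ → δ (Sample.app t (Sample.lst t)) = ⊤
  one_eq : ∀ α : Sample, Sample.app BasicTerm.one α ∈ Δ →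
    δ (Sample.app BasicTerm.one α) = δ α
  last_one : Sample.lst BasicTerm.one ∈ Δ → δ (Sample.lst BasicTerm.one) = ⊤
  mul_eq : ∀ (t u : BasicTerm) (α : Sample), Sample.app (t.mul u) α ∈ Δ →
    δ (Sample.app (t.mul u) α) = δ (Sample.app t (Sample.app u α))
  last_mul : ∀ t u : BasicTerm, Sample.lst (t.mul u) ∈ Δ → Sample.lst t ∈ Δ →
    Sample.lst u ∈ Δ → δ (Sample.lst (t.mul u)) = ⊤ →
    δ (Sample.lst t) = ⊤ ∧ δ (Sample.lst u) = ⊤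
  inv_lower : ∀ (t : BasicTerm) (α : Sample), Sample.app t.star α ∈ Δ →
    0 < δ α → δ α < ⊤ → δ (Sample.app t (Sample.app t.star α)) < δ α
  inv_upper : ∀ (t : BasicTerm) (α : Sample), Sample.app t.star α ∈ Δ →
    δ (Sample.app t.star α) < ⊤ →
    δ α ≤ δ (Sample.app t (Sample.suc (Sample.app t.star α)))
  inv_last : ∀ t : BasicTerm, Sample.lst t.star ∈ Δ → Sample.lst t ∈ Δ →
    δ (Sample.lst t.star) = ⊤ → δ (Sample.lst t) = ⊤

namespace PreservesSSup

variable {f g : ℕ∞ → ℕ∞}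

theorem monotone_s14 (hf : PreservesSSup f) : Monotone f := by
  intro a b hab
  have h := hf {a, b}
  rw [sSup_pair, sup_eq_right.2 hab, Set.image_pair, sSup_pair] at h
  exact h ▸ le_sup_left

theorem map_zero (hf : PreservesSSup f) : f 0 = 0 := by
  simpa using hf ∅

theorem exists_nat_le_apply (hf : PreservesSSup f) {m : ℕ} (hm : (m : ℕ∞) ≤ f ⊤) :
    ∃ k : ℕ, (m : ℕ∞) ≤ f k := by
  rcases m with _ | j
  · exact ⟨0, by simp⟩
  · have htop : sSup (Set.range ((↑) : ℕ → ℕ∞)) = ⊤ := by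
      refine sSup_eq_top.2 fun b hb => ?_
      lift b to ℕ using hb.ne
      exact ⟨_, ⟨b + 1, rfl⟩, by exact_mod_cast b.lt_succ_self⟩
    rw [← htop, hf] at hm
    have hj : (j : ℕ∞) < sSup (f '' Set.range ((↑) : ℕ → ℕ∞)) :=
      lt_of_lt_of_le (by exact_mod_cast j.lt_succ_self) hm
    obtain ⟨_, ⟨_, ⟨k, rfl⟩, rfl⟩, hk⟩ := lt_sSup_iff.1 hj
    exact ⟨k, by exact_mod_cast Order.add_one_le_of_lt hk⟩

theorem id : PreservesSSup id := fun S => by simp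

theorem comp_s14 (hf : PreservesSSup f) (hg : PreservesSSup g) : PreservesSSup (f ∘ g) := fun S => by
  rw [Function.comp_apply, hg, hf, Set.image_image]; rfl

end PreservesSSup

theorem wpred_top : wpred ⊤ = ⊤ := if_pos rfl

theorem wpred_coe (n : ℕ) : wpred n = ((n - 1 : ℕ) : ℕ∞) := by simp [wpred]

theorem wpred_add_one (n : ℕ∞) : wpred (n + 1) = n := by
  induction n using ENat.recTopCoe with
  | top => exact wpred_top
  | coe n => exact_mod_cast wpred_coe (n + 1)

theorem le_wpred_add_one (n : ℕ∞) : n ≤ wpred n + 1 := by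
  induction n using ENat.recTopCoe with
  | top => simp [wpred_top]
  | coe n => rw [wpred_coe]; exact_mod_cast (by omega : n ≤ n - 1 + 1)

section winv

variable {f : ℕ∞ → ℕ∞} {m n : ℕ∞}

theorem winv_le (h : m ≤ f n) : winv f m ≤ wpred n := sInf_le ⟨n, h, rfl⟩

theorem exists_winv_eq (h : winv f m ≠ ⊤) : ∃ n, m ≤ f n ∧ winv f m = wpred n := by
  refine csInf_mem (s := {y | ∃ n : ℕ∞, m ≤ f n ∧ y = wpred n}) ?_
  by_contra he
  exact h (by rw [winv, Set.not_nonempty_iff_eq_empty.1 he, sInf_empty])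

theorem winv_eq_top (h : ∀ n, f n < m) : winv f m = ⊤ := by
  by_contra hne
  obtain ⟨n, hn, -⟩ := exists_winv_eq hne
  exact (h n).not_ge hn

theorem winv_mono : Monotone (winv f) := by
  intro a b hab
  refine sInf_le_sInf ?_
  rintro _ ⟨n, hn, rfl⟩
  exact ⟨n, hab.trans hn, rfl⟩

theorem le_apply_winv_add_one (hf : Monotone f) (h : winv f m ≠ ⊤) : m ≤ f (winv f m + 1) := by
  obtain ⟨n, hn, he⟩ := exists_winv_eq h
  rw [he]
  exact hn.trans (hf (le_wpred_add_one n))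

theorem PreservesSSup.winv (hf : PreservesSSup f) : PreservesSSup (winv f) := by
  intro S
  refine le_antisymm ?_ (sSup_le ?_)
  · by_cases hp : sSup (_root_.winv f '' S) = ⊤
    · exact hp ▸ le_top
    · rw [← wpred_add_one (sSup (_root_.winv f '' S))]
      refine winv_le (sSup_le fun s hs => ?_)
      have hle := le_sSup (Set.mem_image_of_mem (_root_.winv f) hs)
      exact (le_apply_winv_add_one hf.monotone_s14 (ne_top_of_le_ne_top hp hle)).trans
        (hf.monotone_s14 (by gcongr))
  · rintro _ ⟨s, hs, rfl⟩
    exact winv_mono (le_sSup hs)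

theorem apply_winv_lt (hf : PreservesSSup f) (h0 : 0 < m) (hm : m < ⊤) : f (winv f m) < m := by
  by_contra! hle
  have hfin : winv f m ≠ ⊤ := by
    intro htop
    rw [htop] at hle
    lift m to ℕ using hm.ne
    obtain ⟨k, hk⟩ := hf.exists_nat_le_apply hle
    have := winv_le hk
    rw [htop, wpred_coe] at this
    exact ENat.natCast_ne_top _ (top_le_iff.1 this)
  have h := winv_le hle
  obtain ⟨p, hp⟩ := ENat.ne_top_iff_exists.1 hfin
  rw [← hp] at h hle
  rw [wpred_coe] at h
  have hp0 : p = 0 := by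
    have : p ≤ p - 1 := by exact_mod_cast h
    omega
  rw [hp0, Nat.cast_zero, hf.map_zero] at hle
  exact h0.not_ge hle

end winv

/-- The least argument at which `f` attains the value `f ⊤`. -/
noncomputable def wlast (f : ℕ∞ → ℕ∞) : ℕ∞ := sInf {m | f m = f ⊤}

section wlast

variable {f g : ℕ∞ → ℕ∞} {m : ℕ∞}

theorem apply_wlast (f : ℕ∞ → ℕ∞) : f (wlast f) = f ⊤ :=
  csInf_mem (s := {m | f m = f ⊤}) ⟨⊤, rfl⟩

theorem wlast_le (h : f m = f ⊤) : wlast f ≤ m := sInf_le h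

theorem apply_ne_apply_top (h : wlast f = ⊤) (hm : m ≠ ⊤) : f m ≠ f ⊤ := fun he =>
  hm (top_le_iff.1 (h ▸ wlast_le he))

theorem wlast_le_iff (hf : Monotone f) : wlast f ≤ m ↔ f (wlast f) = f m := by
  refine ⟨fun h => le_antisymm (hf h) ?_, fun h => wlast_le ?_⟩
  · rw [apply_wlast f]; exact hf le_top
  · rw [← h, apply_wlast f]

theorem apply_top_of_wlast_eq_top (hf : PreservesSSup f) (h : wlast f = ⊤) : f ⊤ = ⊤ := by
  by_contra hne
  obtain ⟨j, hj⟩ := ENat.ne_top_iff_exists.1 hne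
  obtain ⟨k, hk⟩ := hf.exists_nat_le_apply hj.le
  exact apply_ne_apply_top h (ENat.natCast_ne_top k)
    (le_antisymm (hf.monotone_s14 le_top) (hj ▸ hk))

theorem wlast_id : wlast id = ⊤ := apply_wlast id

theorem wlast_right_of_comp (h : wlast (f ∘ g) = ⊤) : wlast g = ⊤ := by
  by_contra hne
  exact apply_ne_apply_top h hne (congrArg f (apply_wlast g))

theorem wlast_left_of_comp (hf : PreservesSSup f) (hg : PreservesSSup g)
    (h : wlast (f ∘ g) = ⊤) : wlast f = ⊤ := by
  by_contra hne
  have hgt := apply_top_of_wlast_eq_top hg (wlast_right_of_comp h)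
  obtain ⟨j, hj⟩ := ENat.ne_top_iff_exists.1 hne
  obtain ⟨k, hk⟩ := hg.exists_nat_le_apply (m := j) (by simp [hgt])
  refine apply_ne_apply_top h (ENat.natCast_ne_top k) ?_
  rw [Function.comp_apply, Function.comp_apply, hgt,
    ← (wlast_le_iff hf.monotone_s14).1 (hj ▸ hk), apply_wlast f]

theorem wlast_of_winv (hf : PreservesSSup f) (h : wlast (winv f) = ⊤) : wlast f = ⊤ := by
  by_contra hne
  have htop := apply_top_of_wlast_eq_top hf.winv h
  obtain ⟨j, hj⟩ := ENat.ne_top_iff_exists.1 hne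
  by_cases hft : f ⊤ = ⊤
  · have hle : winv f ⊤ ≤ wpred j := winv_le (by rw [hj, apply_wlast f, hft])
    rw [htop, wpred_coe] at hle
    exact ENat.natCast_ne_top _ (top_le_iff.1 hle)
  · refine apply_ne_apply_top h (m := f ⊤ + 1) (by simpa using hft) ?_
    rw [htop]
    exact winv_eq_top fun n =>
      (hf.monotone_s14 le_top).trans_lt ((ENat.lt_add_one_iff hft).2 le_rfl)

end wlast

theorem preservesSSup_eval {h : ℕ → ℕ∞ → ℕ∞} (hh : ∀ i, PreservesSSup (h i)) {t : Term}
    (ht : IsBasic t) : PreservesSSup (eval h t) := by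
  induction ht with
  | var i => exact hh i
  | one => exact PreservesSSup.id
  | mul _ _ iht ihu => exact iht.comp_s14 ihu
  | star _ ih => exact ih.winv

/-- The value of a sample when every time variable is sent to `n`. -/
noncomputable def Sample.eval (h : ℕ → ℕ∞ → ℕ∞) (n : ℕ∞) : Sample → ℕ∞
  | kappa _ => n
  | app t α => _root_.eval h t.1 (α.eval h n)
  | suc α => eS (α.eval h n)
  | lst t => wlast (_root_.eval h t.1)

theorem isDiagram_sampleEval {h : ℕ → ℕ∞ → ℕ∞} (hh : ∀ i, PreservesSSup (h i)) (n : ℕ∞)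
    (Δ : Set Sample) : IsDiagram Δ (Sample.eval h n) := by
  have hw (t : BasicTerm) : PreservesSSup (eval h t.1) := preservesSSup_eval hh t.2
  constructor
  case mon => exact fun t _ _ _ _ hle => (hw t).monotone_s14 hle
  case zero => exact fun t _ _ h0 => (congrArg (eval h t.1) h0).trans (hw t).map_zero
  case suc_eq => exact fun _ _ => rfl
  case last_iff => exact fun t _ _ => wlast_le_iff (hw t).monotone_s14
  case last_top =>
    exact fun t _ hl => (apply_wlast _).trans (apply_top_of_wlast_eq_top (hw t) hl)
  case one_eq => exact fun _ _ => rfl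
  case last_one => exact fun _ => wlast_id
  case mul_eq => exact fun _ _ _ _ => rfl
  case last_mul =>
    exact fun t u _ _ _ hl => ⟨wlast_left_of_comp (hw t) (hw u) hl, wlast_right_of_comp hl⟩
  case inv_lower => exact fun t _ _ h0 h1 => apply_winv_lt (hw t) h0 h1
  case inv_upper => exact fun t _ _ hl => le_apply_winv_add_one (hw t).monotone_s14 hl.ne
  case inv_last => exact fun t _ _ hl => wlast_of_winv (hw t) hl

/-- From any assignment of time warps and any `n ∈ ℕ∞` one obtains a `Δ`-diagram
recording the corresponding evaluations. -/
theorem stmt14 (T : Set BasicTerm) (hT : T.Finite) (κ₀ : ℕ) (Δ : Set Sample)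
    (hΔ : Δ = saturation {s | ∃ t ∈ T, s = Sample.app t (Sample.kappa κ₀)}) :
    ∀ h : ℕ → ℕ∞ → ℕ∞, (∀ i, PreservesSSup (h i)) → ∀ n : ℕ∞,
      ∃ δ : Sample → ℕ∞, IsDiagram Δ δ ∧ δ (Sample.kappa κ₀) = n ∧
        ∀ t ∈ T, δ (Sample.app t (Sample.kappa κ₀)) = eval h t.1 n := by
  exact fun h hh n => ⟨Sample.eval h n, isDiagram_sampleEval hh n Δ, rfl, fun _ _ => rfl⟩
end
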